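/- For every α, β ∈ (0,1), the sequence a_n := H(X^n | y(X^n,D^n), D_0, D_{n+1}) is superadditive: for all integers 1 ≤ m < n, a_n ≥ a_m + a_{n−m}. Consequently the limit lim_{n→∞} a_n/n exists (and equals sup_n a_n/n, which is at most 1). -/

import Mathlib

open Filter

noncomputable section

open scoped Classical

namespace SyncDeletion

/-- The deletion output `y(x, d)`: the subsequence of `x` consisting of the bits `x i`
with `d i = false`, in order. -/
def yList (x d : List Bool) : List Bool :=
  ((x.zip d).filter (fun p => p.2 = false)).map Prod.fst

/-- Binary entropy function (base-2), with `binEnt 0 = binEnt 1 = 0`. -/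
def binEnt (p : ℝ) : ℝ := -(p * Real.logb 2 p) - (1 - p) * Real.logb 2 (1 - p)

/-- The constant `C = ∑_{l≥1} 2^{-l-1} l log₂ l` (the `l = 0` term vanishes). -/
def Cconst : ℝ := ∑' l : ℕ, (2 : ℝ) ^ (-(l : ℝ) - 1) * (l : ℝ) * Real.logb 2 (l : ℝ)

/-- Probability of an event `E` under a pmf `p` on a finite outcome space. -/
def prob {Ω : Type} [Fintype Ω] (p : Ω → ℝ) (E : Ω → Prop) : ℝ :=
  ∑ ω ∈ Finset.univ.filter E, p ω

/-- Conditional Shannon entropy (in bits) `H(f | g)` of the random variable `f`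
given `g`, under the pmf `p`. -/
def condEnt {Ω A B : Type} [Fintype Ω] (p : Ω → ℝ) (f : Ω → A) (g : Ω → B) : ℝ :=
  -∑ ab ∈ Finset.univ.image (fun ω => (f ω, g ω)),
    (if prob p (fun ω => f ω = ab.1 ∧ g ω = ab.2) = 0 then 0
     else prob p (fun ω => f ω = ab.1 ∧ g ω = ab.2) *
       Real.logb 2 (prob p (fun ω => f ω = ab.1 ∧ g ω = ab.2) /
         prob p (fun ω => g ω = ab.2)))

/-- Shannon entropy (in bits) `H(f)` of the random variable `f` under the pmf `p`. -/
def ent {Ω A : Type} [Fintype Ω] (p : Ω → ℝ) (f : Ω → A) : ℝ :=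
  condEnt p f (fun _ => ())

/-- Stationary initial distribution of the deletion-pattern Markov chain:
`P(D₀ = 1) = β/(α+β)`. -/
def initD (α β : ℝ) (b : Bool) : ℝ := if b then β / (α + β) else α / (α + β)

/-- Transition probabilities of the deletion-pattern Markov chain:
`P(1|1) = 1-α`, `P(0|1) = α`, `P(1|0) = β`, `P(0|0) = 1-β`. -/
def transD (α β : ℝ) (b b' : Bool) : ℝ :=
  if b then (if b' then 1 - α else α) else (if b' then β else 1 - β)

/-- Probability of a trajectory of the stationary two-state Markov chain. -/
def pMarkov (α β : ℝ) {m : ℕ} (dp : Fin (m + 1) → Bool) : ℝ :=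
  initD α β (dp 0) * ∏ i : Fin m, transD α β (dp i.castSucc) (dp i.succ)

/-- Joint pmf of the iid Bernoulli(1/2) source `X^n = ω.1` and the independent
deletion pattern `(D_0, …, D_{n+1}) = ω.2`. -/
def pJoint (α β : ℝ) (n : ℕ) (ω : (Fin n → Bool) × (Fin (n + 2) → Bool)) : ℝ :=
  (1 / 2 : ℝ) ^ n * pMarkov α β (m := n + 1) ω.2

/-- The deletion output `y(X^n, D^n)`: bits `X_i` with `D_i = 0` in order
(source bit `X_i` is governed by pattern bit `D_i`, i.e. index `i` of `ω.2`,
for `i = 1, …, n`). -/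
def yOut {n : ℕ} (ω : (Fin n → Bool) × (Fin (n + 2) → Bool)) : List Bool :=
  yList (List.ofFn ω.1)
    (List.ofFn (fun i : Fin n => ω.2 ⟨i.val + 1, by have := i.isLt; omega⟩))

/-- `a_n = H(X^n | y(X^n, D^n), D_0, D_{n+1})`. -/
def aSeq (α β : ℝ) (n : ℕ) : ℝ :=
  condEnt (pJoint α β n) (fun ω => ω.1)
    (fun ω => (yOut ω, ω.2 0, ω.2 (Fin.last (n + 1))))

/-- `E_n = H(D_1 | D_0, X^n, y(X^n, D^n), D_{n+1})`. -/
def Eseq (α β : ℝ) (n : ℕ) : ℝ :=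
  condEnt (pJoint α β n) (fun ω => ω.2 1)
    (fun ω => (ω.2 0, ω.1, yOut ω, ω.2 (Fin.last (n + 1))))

/-- `H(y(X^n, D^n) | X^n, D_0, D_{n+1})`. -/
def hygSeq (α β : ℝ) (n : ℕ) : ℝ :=
  condEnt (pJoint α β n) (fun ω => yOut ω)
    (fun ω => (ω.1, ω.2 0, ω.2 (Fin.last (n + 1))))

/-- `J_n = d + (1/n) H(y(X^n, D^n) | X^n, D_0, D_{n+1})` with `d = β/(α+β)`. -/
def Jseq (α β : ℝ) (n : ℕ) : ℝ := β / (α + β) + hygSeq α β n / n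

/-- `I_n/n`: the normalized mutual information
`(1/n)(H(y(X^n,D^n)) - H(y(X^n,D^n)|X^n))`. -/
def Iseq (α β : ℝ) (n : ℕ) : ℝ :=
  (ent (pJoint α β n) (fun ω => yOut ω) -
    condEnt (pJoint α β n) (fun ω => yOut ω) (fun ω => ω.1)) / n

/-- Error probability of a code `(enc, dec)` with message set `Fin M`. -/
def errProb (α β : ℝ) (n M : ℕ) (enc : (Fin n → Bool) → Fin M)
    (dec : Fin M × List Bool → (Fin n → Bool)) : ℝ :=
  prob (pJoint α β n) (fun ω => dec (enc ω.1, yOut ω) ≠ ω.1)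

/-- `R` is an achievable rate: there is a sequence of codes whose error probability
tends to `0` and whose rate `(1/n) log₂ |M_n|` has limsup at most `R`. -/
def IsAchievable (α β R : ℝ) : Prop :=
  ∃ M : ℕ → ℕ, ∃ enc : (n : ℕ) → (Fin n → Bool) → Fin (M n),
    ∃ dec : (n : ℕ) → Fin (M n) × List Bool → (Fin n → Bool),
      Tendsto (fun n => errProb α β n (M n) (enc n) (dec n)) atTop (nhds 0) ∧
      Filter.limsup (fun n : ℕ => Real.logb 2 (M n : ℝ) / (n : ℝ)) atTop ≤ R

/-- The minimum achievable rate `R_min(α, β)`. -/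
def Rmin (α β : ℝ) : ℝ := sInf {R : ℝ | IsAchievable α β R}

/-- `k = max {6, -6 / log₂(1-α)}`. -/
def kconst (α : ℝ) : ℝ := max 6 (-6 / Real.logb 2 (1 - α))

/-- `m = ⌊-k log₂ β⌋`. -/
def mlen (α β : ℝ) : ℕ := ⌊kconst α * (-Real.logb 2 β)⌋₊

/-- Number of ones among the entries of `dp` with index `≤ m`. -/
def onesCount {N : ℕ} (dp : Fin N → Bool) (m : ℕ) : ℕ :=
  (Finset.univ.filter (fun i : Fin N => i.val ≤ m ∧ dp i = true)).card

/-- Number of maximal runs of 1's among the entries of `dp` with index `≤ m`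
(counted by their starting positions). -/
def runsCount {N : ℕ} (dp : Fin N → Bool) (m : ℕ) : ℕ :=
  (Finset.univ.filter (fun i : Fin N => i.val ≤ m ∧ dp i = true ∧
    (i.val = 0 ∨ dp ⟨i.val - 1, lt_of_le_of_lt (Nat.sub_le _ _) i.isLt⟩ = false))).card

/-- The deletion pattern `(D_0, …, D_{n+1})` is typical: `(D_0, …, D_m)` contains at
most one maximal run of 1's and at most `⌊(k/3)(-log₂ β)⌋` ones, for `m = ⌊-k log₂ β⌋`. -/
def Typical (α β : ℝ) {n : ℕ} (dp : Fin (n + 2) → Bool) : Prop :=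
  runsCount dp (mlen α β) ≤ 1 ∧
    onesCount dp (mlen α β) ≤ ⌊(kconst α / 3) * (-Real.logb 2 β)⌋₊

/-- The joint pmf conditioned on the event `{T = 1}` that the deletion pattern is typical. -/
def pTypCond (α β : ℝ) (n : ℕ) (ω : (Fin n → Bool) × (Fin (n + 2) → Bool)) : ℝ :=
  if Typical α β ω.2 then
    pJoint α β n ω / prob (pJoint α β n) (fun ω' => Typical α β ω'.2)
  else 0

/-- `H(D_1 | X^n, y(X^n,D^n), D_0, D_{n+1}, T = 1) ⬝ P(T = 1)`. -/
def EseqTyp (α β : ℝ) (n : ℕ) : ℝ :=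
  condEnt (pTypCond α β n) (fun ω => ω.2 1)
    (fun ω => (ω.2 0, ω.1, yOut ω, ω.2 (Fin.last (n + 1)))) *
  prob (pJoint α β n) (fun ω => Typical α β ω.2)

/-- `(1/k) H(X_2^{k-1} | y(X_2^{k-1}, D_2^{k-1}), D_1, D_k)` (unnormalized). -/
def innerEnt (α β : ℝ) (k : ℕ) : ℝ :=
  condEnt (pJoint α β k)
    (fun ω => (fun i : Fin (k - 2) => ω.1 ⟨i.val + 1, by have := i.isLt; omega⟩))
    (fun ω =>
      (yList (List.ofFn (fun i : Fin (k - 2) => ω.1 ⟨i.val + 1, by have := i.isLt; omega⟩))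
        (List.ofFn (fun i : Fin (k - 2) => ω.2 ⟨i.val + 2, by have := i.isLt; omega⟩)),
       ω.2 1, ω.2 ⟨k, by omega⟩))


section Entropy

variable {Ω A B C : Type} [Fintype Ω]

/-- The probability of the fibre of `k` through `ω`. -/
def fiberProb (p : Ω → ℝ) (k : Ω → A) (ω : Ω) : ℝ :=
  ∑ ω', if k ω' = k ω then p ω' else 0

/-- The entropy of `k`, written as an expectation over outcomes. -/
def fiberEnt (p : Ω → ℝ) (k : Ω → A) : ℝ :=
  -∑ ω, p ω * Real.logb 2 (fiberProb p k ω)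

lemma fiberProb_congr (p : Ω → ℝ) {k : Ω → A} {l : Ω → B}
    (h : ∀ ω ω', k ω = k ω' ↔ l ω = l ω') (ω : Ω) :
    fiberProb p k ω = fiberProb p l ω := by
  simp only [fiberProb, h]

lemma fiberEnt_congr (p : Ω → ℝ) {k : Ω → A} {l : Ω → B}
    (h : ∀ ω ω', k ω = k ω' ↔ l ω = l ω') : fiberEnt p k = fiberEnt p l := by
  simp only [fiberEnt, fiberProb_congr p h]

lemma fiberProb_pos {p : Ω → ℝ} (hp : ∀ ω, 0 < p ω) (k : Ω → A) (ω : Ω) :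
    0 < fiberProb p k ω := by
  refine Finset.sum_pos' (fun ω' _ => ?_) ⟨ω, Finset.mem_univ _, by simpa using hp ω⟩
  split_ifs
  exacts [(hp ω').le, le_rfl]

lemma fiberProb_of_eq (p : Ω → ℝ) {k : Ω → A} {ω ω' : Ω} (h : k ω = k ω') :
    fiberProb p k ω = fiberProb p k ω' := by
  simp only [fiberProb, h]

lemma condEnt_eq_sum (p : Ω → ℝ) (f : Ω → A) (g : Ω → B) :
    condEnt p f g = -∑ ω, p ω *
      Real.logb 2 (fiberProb p (fun ω => (f ω, g ω)) ω / fiberProb p g ω) := by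
  unfold condEnt
  rw [← Finset.sum_fiberwise_of_maps_to (s := Finset.univ)
    (t := Finset.univ.image (fun ω => (f ω, g ω))) (g := fun ω => (f ω, g ω))
    (fun ω _ => Finset.mem_image_of_mem _ (Finset.mem_univ ω))]
  congr 1
  refine Finset.sum_congr rfl fun ab _ => ?_
  have hsum : ∑ ω with (f ω, g ω) = ab, p ω *
      Real.logb 2 (fiberProb p (fun ω => (f ω, g ω)) ω / fiberProb p g ω) =
      prob p (fun ω => f ω = ab.1 ∧ g ω = ab.2) *
        Real.logb 2 (prob p (fun ω => f ω = ab.1 ∧ g ω = ab.2) /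
          prob p (fun ω => g ω = ab.2)) := by
    conv_rhs => enter [1]; unfold prob
    rw [Finset.sum_mul]
    refine Finset.sum_congr (by ext; simp [Prod.ext_iff]) fun ω hω => ?_
    simp only [Finset.mem_filter, Finset.mem_univ, true_and] at hω
    simp only [prob, fiberProb, Finset.sum_filter, Prod.mk.injEq, hω.1, hω.2]
    congr!
  rw [hsum]
  split_ifs with h0
  · rw [h0, zero_mul]
  · rfl

lemma condEnt_eq_fiberEnt {p : Ω → ℝ} (hp : ∀ ω, 0 < p ω) (f : Ω → A) (g : Ω → B) :
    condEnt p f g = fiberEnt p (fun ω => (f ω, g ω)) - fiberEnt p g := by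
  rw [condEnt_eq_sum, fiberEnt, fiberEnt, neg_sub_neg, ← Finset.sum_sub_distrib,
    ← Finset.sum_neg_distrib]
  refine Finset.sum_congr rfl fun ω _ => ?_
  rw [Real.logb_div (fiberProb_pos hp _ ω).ne' (fiberProb_pos hp _ ω).ne']
  ring

lemma condEnt_prodMk {p : Ω → ℝ} (hp : ∀ ω, 0 < p ω) (f : Ω → A) (f' : Ω → C) (g : Ω → B) :
    condEnt p (fun ω => (f ω, f' ω)) g =
      condEnt p f g + condEnt p f' (fun ω => (f ω, g ω)) := by
  simp only [condEnt_eq_fiberEnt hp]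
  rw [fiberEnt_congr p (k := fun ω => ((f ω, f' ω), g ω)) (l := fun ω => (f' ω, f ω, g ω))
    (by intros; simp only [Prod.mk.injEq]; tauto)]
  ring

lemma condEnt_congr (p : Ω → ℝ) {A' B' : Type} {f : Ω → A} {f' : Ω → A'} {g : Ω → B} {g' : Ω → B'}
    (hf : ∀ ω ω', f ω = f ω' ↔ f' ω = f' ω') (hg : ∀ ω ω', g ω = g ω' ↔ g' ω = g' ω') :
    condEnt p f g = condEnt p f' g' := by
  simp only [condEnt_eq_sum, fiberProb_congr p hg]
  simp only [fiberProb_congr p (k := fun ω => (f ω, g ω)) (l := fun ω => (f' ω, g' ω))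
    (fun ω ω' => by simp only [Prod.mk.injEq, hf, hg])]

lemma condEnt_comp_equiv {Ω' : Type} [Fintype Ω'] (e : Ω' ≃ Ω) (p : Ω → ℝ) (f : Ω → A)
    (g : Ω → B) : condEnt p f g = condEnt (p ∘ e) (f ∘ e) (g ∘ e) := by
  simp only [condEnt_eq_sum, fiberProb]
  rw [← Equiv.sum_comp e]
  congr 1
  refine Finset.sum_congr rfl fun ω _ => ?_
  rw [← Equiv.sum_comp e, ← Equiv.sum_comp e (fun ω' => if g ω' = g (e ω) then p ω' else 0)]
  rfl

/-- Gibbs' inequality. -/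
lemma sum_mul_logb_nonpos {p r : Ω → ℝ} (hp : ∀ ω, 0 < p ω) (hr : ∀ ω, 0 < r ω)
    (h : ∑ ω, p ω * r ω ≤ ∑ ω, p ω) : ∑ ω, p ω * Real.logb 2 (r ω) ≤ 0 := by
  have hlog : ∑ ω, p ω * Real.log (r ω) ≤ ∑ ω, (p ω * r ω - p ω) :=
    Finset.sum_le_sum fun ω _ => by
      nlinarith [Real.log_le_sub_one_of_pos (hr ω), hp ω]
  rw [Finset.sum_sub_distrib] at hlog
  have h2 : (0 : ℝ) < Real.log 2 := Real.log_pos (by norm_num)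
  simp only [Real.logb, ← mul_div_assoc, ← Finset.sum_div]
  exact div_nonpos_of_nonpos_of_nonneg (by linarith) h2.le

lemma sum_fiber_div_fiberProb_le {p : Ω → ℝ} (hp : ∀ ω, 0 < p ω) (k : Ω → A) (a : A) :
    ∑ ω, (if k ω = a then p ω / fiberProb p k ω else 0) ≤ 1 := by
  by_cases ha : ∃ ω, k ω = a
  · obtain ⟨ω₀, rfl⟩ := ha
    have hpos := fiberProb_pos hp k ω₀
    rw [← div_self hpos.ne']
    conv_rhs => enter [1]; unfold fiberProb
    rw [Finset.sum_div]
    refine Finset.sum_le_sum fun ω _ => ?_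
    split_ifs with h
    · rw [fiberProb_of_eq p h]
    · simp
  · push Not at ha
    simp [ha]

/-- Conditioning on a finer variable decreases the conditional entropy. -/
lemma condEnt_anti {p : Ω → ℝ} (hp : ∀ ω, 0 < p ω) (f : Ω → A) {g : Ω → B} {h : Ω → C}
    (hgh : ∀ ω ω', h ω = h ω' → g ω = g ω') : condEnt p f h ≤ condEnt p f g := by
  set fg : Ω → A × B := fun ω => (f ω, g ω) with hfg
  set fh : Ω → A × C := fun ω => (f ω, h ω) with hfh
  have key : ∑ ω, p ω * Real.logb 2 ((fiberProb p fg ω / fiberProb p g ω) /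
      (fiberProb p fh ω / fiberProb p h ω)) ≤ 0 := by
    refine sum_mul_logb_nonpos hp (fun ω => div_pos
      (div_pos (fiberProb_pos hp _ _) (fiberProb_pos hp _ _))
      (div_pos (fiberProb_pos hp _ _) (fiberProb_pos hp _ _))) ?_
    have inner : ∀ ω', ∑ ω, (if fg ω = fg ω' then
        p ω * fiberProb p h ω / fiberProb p fh ω else 0) ≤ fiberProb p g ω' := by
      intro ω'
      calc _ = ∑ ω, ∑ ω'', (if g ω'' = g ω' then p ω'' *
              (if fh ω = (f ω', h ω'') then p ω / fiberProb p fh ω else 0) else 0) := by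
            refine Finset.sum_congr rfl fun ω _ => ?_
            split_ifs with h1
            · conv_lhs => enter [1, 2]; unfold fiberProb
              rw [Finset.mul_sum, Finset.sum_div]
              refine Finset.sum_congr rfl fun ω'' _ => ?_
              simp only [hfg, hfh, Prod.mk.injEq] at h1 ⊢
              by_cases h2 : h ω'' = h ω
              · have h3 : g ω'' = g ω' := (hgh _ _ h2).trans h1.2
                simp only [h1.1, h2, h3, and_self, if_true]
                ring
              · simp [h2, Ne.symm h2]
            · refine (Finset.sum_eq_zero fun ω'' _ => ?_).symm
              by_cases h2 : g ω'' = g ω'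
              · rw [if_pos h2, if_neg, mul_zero]
                intro h3
                simp only [hfg, hfh, Prod.mk.injEq] at h1 h3
                exact h1 ⟨h3.1, (hgh _ _ h3.2).trans h2⟩
              · rw [if_neg h2]
        _ = ∑ ω'', (if g ω'' = g ω' then p ω'' *
              ∑ ω, (if fh ω = (f ω', h ω'') then p ω / fiberProb p fh ω else 0) else 0) := by
            rw [Finset.sum_comm]
            refine Finset.sum_congr rfl fun ω'' _ => ?_
            split_ifs
            · rw [Finset.mul_sum]
            · simp
        _ ≤ fiberProb p g ω' := by
            refine Finset.sum_le_sum fun ω'' _ => ?_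
            split_ifs
            · refine mul_le_of_le_one_right (hp _).le ?_
              refine le_of_eq_of_le (Finset.sum_congr rfl fun _ _ => ?_)
                (sum_fiber_div_fiberProb_le hp fh (f ω', h ω''))
              congr
            · exact le_rfl
    calc _ = ∑ ω, ∑ ω', (p ω' / fiberProb p g ω') * (if fg ω = fg ω' then
        p ω * fiberProb p h ω / fiberProb p fh ω else 0) := by
          refine Finset.sum_congr rfl fun ω _ => ?_
          conv_lhs => enter [2, 1, 1]; unfold fiberProb
          rw [Finset.sum_div, Finset.sum_div, Finset.mul_sum]
          refine Finset.sum_congr rfl fun ω' _ => ?_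
          by_cases h1 : fg ω = fg ω'
          · have h2 : g ω = g ω' := congrArg Prod.snd h1
            rw [if_pos h1, if_pos h1.symm, fiberProb_of_eq p h2]
            simp only [div_eq_mul_inv, mul_inv, inv_inv]
            ring
          · rw [if_neg h1, if_neg (Ne.symm h1)]
            simp
      _ = ∑ ω', (p ω' / fiberProb p g ω') * ∑ ω, (if fg ω = fg ω' then
        p ω * fiberProb p h ω / fiberProb p fh ω else 0) := by
          rw [Finset.sum_comm]
          simp only [Finset.mul_sum]
      _ ≤ ∑ ω', p ω' := by
          refine Finset.sum_le_sum fun ω' _ => ?_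
          have hg := fiberProb_pos hp g ω'
          calc _ ≤ p ω' / fiberProb p g ω' * fiberProb p g ω' :=
                mul_le_mul_of_nonneg_left (inner ω') (div_pos (hp _) hg).le
            _ = p ω' := div_mul_cancel₀ _ hg.ne'
  rw [condEnt_eq_sum, condEnt_eq_sum, neg_le_neg_iff, ← sub_nonpos, ← Finset.sum_sub_distrib]
  refine le_of_eq_of_le (Finset.sum_congr rfl fun ω _ => ?_) key
  rw [Real.logb_div (div_pos (fiberProb_pos hp _ _) (fiberProb_pos hp _ _)).ne'
    (div_pos (fiberProb_pos hp _ _) (fiberProb_pos hp _ _)).ne']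
  ring

end Entropy

section Markov

variable {U W S A B C : Type} [Fintype U] [Fintype W]

lemma fiberProb_prod (F : U → S → ℝ) (G : W → ℝ) (σ : W → S) (k : U → A) (ψ : W → C)
    (hψ : ∀ w w', ψ w = ψ w' → σ w = σ w') (u : U) (w : W) :
    fiberProb (fun ω : U × W => F ω.1 (σ ω.2) * G ω.2) (fun ω => (k ω.1, ψ ω.2)) (u, w) =
      fiberProb (fun u => F u (σ w)) k u * fiberProb G ψ w := by
  simp only [fiberProb, Fintype.sum_prod_type, Finset.sum_mul_sum, Prod.mk.injEq]
  refine Finset.sum_congr rfl fun u' _ => Finset.sum_congr rfl fun w' _ => ?_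
  by_cases h1 : k u' = k u <;> by_cases h2 : ψ w' = ψ w <;> simp [h1, h2]
  simp [hψ _ _ h2]

/-- If `U` is independent of `W` given the state `σ W`, then conditioning on any `ψ W` which
determines the state is the same as conditioning on the state alone. -/
lemma condEnt_prod_eq_sum [Fintype S] {F : U → S → ℝ} {G : W → ℝ} (hG : ∀ w, 0 < G w) (σ : W → S)
    (f : U → A) (g : U → B) (ψ : W → C) (hψ : ∀ w w', ψ w = ψ w' → σ w = σ w') :
    condEnt (fun ω : U × W => F ω.1 (σ ω.2) * G ω.2) (fun ω => f ω.1)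
      (fun ω => (g ω.1, ψ ω.2)) =
    -∑ u, ∑ s, F u s * (∑ w, if σ w = s then G w else 0) *
      Real.logb 2 (fiberProb (fun u => F u s) (fun u => (f u, g u)) u /
        fiberProb (fun u => F u s) g u) := by
  rw [condEnt_eq_sum, Fintype.sum_prod_type]
  congr 1
  refine Finset.sum_congr rfl fun u _ => ?_
  have hterm : ∀ w, fiberProb (fun ω : U × W => F ω.1 (σ ω.2) * G ω.2)
      (fun ω => (f ω.1, g ω.1, ψ ω.2)) (u, w) /
      fiberProb (fun ω : U × W => F ω.1 (σ ω.2) * G ω.2) (fun ω => (g ω.1, ψ ω.2)) (u, w) =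
      fiberProb (fun u => F u (σ w)) (fun u => (f u, g u)) u /
        fiberProb (fun u => F u (σ w)) g u := by
    intro w
    rw [fiberProb_congr _ (l := fun ω : U × W => ((f ω.1, g ω.1), ψ ω.2))
      (by intros; simp only [Prod.mk.injEq]; tauto),
      fiberProb_prod F G σ (fun u => (f u, g u)) ψ hψ, fiberProb_prod F G σ g ψ hψ,
      mul_div_mul_right _ _ (fiberProb_pos hG ψ w).ne']
  simp only [hterm, Finset.mul_sum, Finset.sum_mul]
  rw [Finset.sum_comm]
  refine Finset.sum_congr rfl fun w _ => ?_
  rw [Finset.sum_eq_single (σ w) (fun s _ hs => by simp [Ne.symm hs]) (by simp)]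
  simp

lemma condEnt_prod_eq [Fintype S] {F : U → S → ℝ} {G : W → ℝ} (hG : ∀ w, 0 < G w) (σ : W → S)
    {c : S → ℝ} (hc : ∀ s, 0 < c s) (hGc : ∀ s, (∑ w, if σ w = s then G w else 0) = c s)
    (f : U → A) (g : U → B) (ψ : W → C) (hψ : ∀ w w', ψ w = ψ w' → σ w = σ w') :
    condEnt (fun ω : U × W => F ω.1 (σ ω.2) * G ω.2) (fun ω => f ω.1)
      (fun ω => (g ω.1, ψ ω.2)) =
    condEnt (fun ω : U × S => F ω.1 ω.2 * c ω.2) (fun ω => f ω.1) (fun ω => (g ω.1, ω.2)) := by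
  refine (condEnt_prod_eq_sum hG σ f g ψ hψ).trans
    (Eq.trans ?_ (condEnt_prod_eq_sum hc id f g (fun s => s) (fun _ _ h => h)).symm)
  simp [hGc]

end Markov

section Chain

variable {α β : ℝ}

lemma transD_pos (hα : 0 < α ∧ α < 1) (hβ : 0 < β ∧ β < 1) (b b' : Bool) :
    0 < transD α β b b' := by
  cases b <;> cases b' <;> simp [transD] <;> linarith

lemma initD_pos (hα : 0 < α ∧ α < 1) (hβ : 0 < β ∧ β < 1) (b : Bool) : 0 < initD α β b := by
  have := hα.1
  have := hβ.1
  cases b <;> simp only [initD] <;> simp <;> positivity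

lemma sum_transD (b : Bool) : ∑ b', transD α β b b' = 1 := by
  cases b <;> simp [transD]

lemma sum_initD (h : α + β ≠ 0) : ∑ b, initD α β b = 1 := by
  simp only [initD, Fintype.sum_bool]
  simp
  field_simp
  ring

lemma sum_initD_mul_transD (h : α + β ≠ 0) (b' : Bool) :
    ∑ b, initD α β b * transD α β b b' = initD α β b' := by
  cases b' <;> simp [initD, transD] <;> field_simp <;> ring

/-- The product of the transition probabilities along a trajectory. -/
def pathWeight (α β : ℝ) {k : ℕ} (d : Fin (k + 1) → Bool) : ℝ :=
  ∏ i : Fin k, transD α β (d i.castSucc) (d i.succ)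

lemma pathWeight_pos (hα : 0 < α ∧ α < 1) (hβ : 0 < β ∧ β < 1) {k : ℕ}
    (d : Fin (k + 1) → Bool) : 0 < pathWeight α β d :=
  Finset.prod_pos fun _ _ => transD_pos hα hβ _ _

lemma pMarkov_pos (hα : 0 < α ∧ α < 1) (hβ : 0 < β ∧ β < 1) {k : ℕ}
    (d : Fin (k + 1) → Bool) : 0 < pMarkov α β d :=
  mul_pos (initD_pos hα hβ _) (pathWeight_pos hα hβ d)

lemma pJoint_pos (hα : 0 < α ∧ α < 1) (hβ : 0 < β ∧ β < 1) (n : ℕ)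
    (ω : (Fin n → Bool) × (Fin (n + 2) → Bool)) : 0 < pJoint α β n ω :=
  mul_pos (by positivity) (pMarkov_pos hα hβ _)

lemma pathWeight_cons {k : ℕ} (s : Bool) (d : Fin (k + 1) → Bool) :
    pathWeight α β (Fin.cons s d : Fin (k + 2) → Bool) =
      transD α β s (d 0) * pathWeight α β d := by
  rw [pathWeight, Fin.prod_univ_succ]
  simp only [Fin.castSucc_zero, Fin.cons_zero, Fin.cons_succ, pathWeight, ← Fin.succ_castSucc]

lemma pathWeight_snoc {k : ℕ} (d : Fin (k + 1) → Bool) (s : Bool) :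
    pathWeight α β (Fin.snoc d s : Fin (k + 2) → Bool) =
      pathWeight α β d * transD α β (d (Fin.last k)) s := by
  rw [pathWeight, Fin.prod_univ_castSucc]
  simp only [Fin.snoc_castSucc, Fin.succ_last, Fin.snoc_last, pathWeight, Fin.succ_castSucc]

lemma pMarkov_snoc {k : ℕ} (d : Fin (k + 1) → Bool) (s : Bool) :
    pMarkov α β (Fin.snoc d s : Fin (k + 2) → Bool) =
      pMarkov α β d * transD α β (d (Fin.last k)) s := by
  have h0 : (Fin.snoc d s : Fin (k + 2) → Bool) 0 = d 0 :=
    Fin.snoc_castSucc (α := fun _ => Bool) s d 0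
  change initD α β _ * pathWeight α β _ = initD α β _ * pathWeight α β _ * _
  rw [pathWeight_snoc, h0, mul_assoc]

/-- The concatenation of two trajectories. -/
def glue {m k : ℕ} (d : Fin (m + 1) → Bool) (d' : Fin (k + 1) → Bool) (i : Fin (m + k + 2)) :
    Bool :=
  Fin.append d d' (Fin.cast (by omega) i)

lemma glue_left {m k : ℕ} (d : Fin (m + 1) → Bool) (d' : Fin (k + 1) → Bool)
    {i : Fin (m + k + 2)} (j : Fin (m + 1)) (h : i.val = j.val) : glue d d' i = d j := by
  rw [glue, show Fin.cast _ i = Fin.castAdd (k + 1) j from Fin.ext h, Fin.append_left]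

lemma glue_right {m k : ℕ} (d : Fin (m + 1) → Bool) (d' : Fin (k + 1) → Bool)
    {i : Fin (m + k + 2)} (j : Fin (k + 1)) (h : i.val = m + 1 + j.val) :
    glue d d' i = d' j := by
  rw [glue, show Fin.cast _ i = Fin.natAdd (m + 1) j from Fin.ext h, Fin.append_right]

lemma pathWeight_glue {m k : ℕ} (d : Fin (m + 1) → Bool) (d' : Fin (k + 1) → Bool) :
    pathWeight α β (glue d d' : Fin (m + k + 1 + 1) → Bool) =
      pathWeight α β d * transD α β (d (Fin.last m)) (d' 0) * pathWeight α β d' := by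
  rw [pathWeight, ← Fin.prod_congr' _ (show m + 1 + k = m + k + 1 by omega), Fin.prod_univ_add,
    Fin.prod_univ_castSucc]
  refine congrArg₂ _ (congrArg₂ _ (Finset.prod_congr rfl fun i _ => ?_) ?_)
    (Finset.prod_congr rfl fun i _ => ?_)
  · rw [glue_left d d' i.castSucc (by simp), glue_left d d' i.succ (by simp)]
  · rw [glue_left d d' (Fin.last m) (by simp), glue_right d d' 0 (by simp)]
  · rw [glue_right d d' i.castSucc (by simp), glue_right d d' i.succ (by simp; omega)]

lemma pMarkov_glue {m k : ℕ} (d : Fin (m + 1) → Bool) (d' : Fin (k + 1) → Bool) :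
    pMarkov α β (glue d d' : Fin (m + k + 1 + 1) → Bool) =
      pMarkov α β d * transD α β (d (Fin.last m)) (d' 0) * pathWeight α β d' := by
  change initD α β _ * pathWeight α β _ = initD α β _ * pathWeight α β _ * _ * _
  rw [pathWeight_glue, glue_left d d' 0 (by simp)]
  ring

lemma sum_pathWeight {k : ℕ} (s : Bool) :
    (∑ d : Fin (k + 1) → Bool, if d 0 = s then pathWeight α β d else 0) = 1 := by
  induction k generalizing s with
  | zero =>
    rw [← Equiv.sum_comp (Equiv.funUnique (Fin 1) Bool).symm]
    simp [pathWeight]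
  | succ k ih =>
    rw [← Equiv.sum_comp (Fin.consEquiv fun _ => Bool), Fintype.sum_prod_type]
    have hcons : ∀ (t : Bool) (d : Fin (k + 1) → Bool),
        (Fin.consEquiv fun _ => Bool) (t, d) = Fin.cons t d := fun _ _ => rfl
    simp only [hcons, Fin.cons_zero, pathWeight_cons]
    rw [Finset.sum_eq_single s (fun b _ hb => by simp [hb]) (by simp)]
    simp only [if_true]
    calc _ = ∑ d : Fin (k + 1) → Bool, ∑ t, transD α β s t *
          (if d 0 = t then pathWeight α β d else 0) := by simp
      _ = 1 := by
        rw [Finset.sum_comm]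
        simp only [← Finset.mul_sum, ih, mul_one, sum_transD]

lemma sum_pMarkov_last (h : α + β ≠ 0) {k : ℕ} (s : Bool) :
    (∑ d : Fin (k + 1) → Bool, if d (Fin.last k) = s then pMarkov α β d else 0) =
      initD α β s := by
  induction k generalizing s with
  | zero =>
    rw [← Equiv.sum_comp (Equiv.funUnique (Fin 1) Bool).symm]
    simp [pMarkov]
  | succ k ih =>
    rw [← Equiv.sum_comp (Fin.snocEquiv fun _ => Bool), Fintype.sum_prod_type]
    simp only [Fin.snocEquiv, Equiv.coe_fn_mk, Fin.snoc_last]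
    rw [Finset.sum_eq_single s (fun b _ hb => by simp [hb]) (by simp)]
    simp only [if_true]
    calc _ = ∑ d : Fin (k + 1) → Bool, ∑ t,
          (if d (Fin.last k) = t then pMarkov α β d else 0) * transD α β t s := by
          simp [← pMarkov_snoc]
      _ = initD α β s := by
        rw [Finset.sum_comm]
        simp only [← Finset.sum_mul, ih, sum_initD_mul_transD h]

lemma sum_pMarkov (h : α + β ≠ 0) {k : ℕ} : ∑ d : Fin (k + 1) → Bool, pMarkov α β d = 1 := by
  calc _ = ∑ d : Fin (k + 1) → Bool, ∑ s, if d (Fin.last k) = s then pMarkov α β d else 0 := by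
        simp
    _ = 1 := by
        rw [Finset.sum_comm]
        simp only [sum_pMarkov_last h, sum_initD h]

lemma sum_source (k : ℕ) (c : ℝ) : ∑ _x : Fin k → Bool, (1 / 2 : ℝ) ^ k * c = c := by
  simp

end Chain

section Split

variable {α β : ℝ}

/-- A block of source bits together with `k + 1` consecutive states of the deletion pattern. -/
abbrev Block (k : ℕ) : Type := (Fin k → Bool) × (Fin (k + 1) → Bool)

/-- The deletion output of a block whose first state precedes the source bits. -/
def outTail {k : ℕ} (u : Block k) : List Bool :=
  yList (List.ofFn u.1) (List.ofFn fun i => u.2 i.succ)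

/-- The deletion output of a block whose last state follows the source bits. -/
def outInit {k : ℕ} (u : Block k) : List Bool :=
  yList (List.ofFn u.1) (List.ofFn fun i => u.2 i.castSucc)

lemma yList_append {x x' d d' : List Bool} (h : x.length = d.length) :
    yList (x ++ x') (d ++ d') = yList x d ++ yList x' d' := by
  simp [yList, List.zip_append h]

/-- Splitting off the last state. -/
def snocSplit (k : ℕ) : Block k × Bool ≃ (Fin k → Bool) × (Fin (k + 2) → Bool) :=
  (Equiv.prodAssoc _ _ _).trans
    ((Equiv.refl _).prodCongr ((Equiv.prodComm _ _).trans (Fin.snocEquiv fun _ => Bool)))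

/-- Splitting off the first state. -/
def consSplit (k : ℕ) : Block k × Bool ≃ (Fin k → Bool) × (Fin (k + 2) → Bool) :=
  (Equiv.prodAssoc _ _ _).trans
    ((Equiv.refl _).prodCongr ((Equiv.prodComm _ _).trans (Fin.consEquiv fun _ => Bool)))

/-- Splitting the whole outcome into a past and a future block. -/
def glueSplit (m k : ℕ) :
    Block m × Block k ≃ (Fin (m + k) → Bool) × (Fin (m + k + 2) → Bool) :=
  (Equiv.prodProdProdComm _ _ _ _).trans
    ((Fin.appendEquiv m k).prodCongr ((Fin.appendEquiv (m + 1) (k + 1)).trans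
      (Equiv.arrowCongr (finCongr (by omega)) (Equiv.refl _))))

lemma snocSplit_apply {k : ℕ} (ω : Block k × Bool) :
    snocSplit k ω = (ω.1.1, (Fin.snoc ω.1.2 ω.2 : Fin (k + 2) → Bool)) := rfl

lemma consSplit_apply {k : ℕ} (ω : Block k × Bool) :
    consSplit k ω = (ω.1.1, (Fin.cons ω.2 ω.1.2 : Fin (k + 2) → Bool)) := rfl

lemma glueSplit_apply {m k : ℕ} (ω : Block m × Block k) :
    glueSplit m k ω = (Fin.append ω.1.1 ω.2.1, glue ω.1.2 ω.2.2) := rfl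

lemma yOut_snocSplit {k : ℕ} (ω : Block k × Bool) : yOut (snocSplit k ω) = outTail ω.1 := by
  rw [snocSplit_apply]
  refine congrArg (yList (List.ofFn ω.1.1)) (congrArg List.ofFn (funext fun i => ?_))
  exact Fin.snoc_castSucc (α := fun _ => Bool) ω.2 ω.1.2 i.succ

lemma yOut_consSplit {k : ℕ} (ω : Block k × Bool) : yOut (consSplit k ω) = outInit ω.1 := by
  rw [consSplit_apply]
  refine congrArg (yList (List.ofFn ω.1.1)) (congrArg List.ofFn (funext fun i => ?_))
  exact Fin.cons_succ (α := fun _ => Bool) ω.2 ω.1.2 i.castSucc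

lemma yOut_glueSplit {m k : ℕ} (ω : Block m × Block k) :
    yOut (glueSplit m k ω) = outTail ω.1 ++ outInit ω.2 := by
  rw [glueSplit_apply, outTail, outInit, ← yList_append (by simp), ← List.ofFn_fin_append,
    ← List.ofFn_fin_append]
  refine congrArg (yList _) (congrArg List.ofFn (funext fun i => ?_))
  refine Fin.addCases (fun j => ?_) (fun j => ?_) i
  · rw [Fin.append_left]
    exact glue_left _ _ j.succ (by simp)
  · rw [Fin.append_right]
    exact glue_right _ _ j.castSucc (by simp; omega)

lemma aSeq_eq_snoc (k : ℕ) :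
    aSeq α β k = condEnt (fun ω : Block k × Bool =>
        (1 / 2 : ℝ) ^ k * pMarkov α β ω.1.2 * transD α β (ω.1.2 (Fin.last k)) ω.2 * 1)
      (fun ω => ω.1.1) (fun ω => ((outTail ω.1, ω.1.2 0), ω.2)) := by
  rw [aSeq, condEnt_comp_equiv (snocSplit k)]
  have hp : pJoint α β k ∘ snocSplit k = fun ω : Block k × Bool =>
      (1 / 2 : ℝ) ^ k * pMarkov α β ω.1.2 * transD α β (ω.1.2 (Fin.last k)) ω.2 * 1 := by
    funext ω
    simp only [Function.comp_apply, snocSplit_apply, pJoint, pMarkov_snoc]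
    ring
  rw [hp]
  refine condEnt_congr _ (fun ω ω' => Iff.rfl) (fun ω ω' => ?_)
  have h0 : ∀ ω : Block k × Bool, (snocSplit k ω).2 0 = ω.1.2 0 := fun ω =>
    Fin.snoc_castSucc (α := fun _ => Bool) ω.2 ω.1.2 0
  have hl : ∀ ω : Block k × Bool, (snocSplit k ω).2 (Fin.last (k + 1)) = ω.2 := fun ω =>
    Fin.snoc_last (α := fun _ => Bool) ω.2 ω.1.2
  simp only [Function.comp_apply, yOut_snocSplit, h0, hl, Prod.mk.injEq]
  tauto

lemma aSeq_eq_cons (k : ℕ) :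
    aSeq α β k = condEnt (fun ω : Block k × Bool =>
        (1 / 2 : ℝ) ^ k * transD α β ω.2 (ω.1.2 0) * pathWeight α β ω.1.2 * initD α β ω.2)
      (fun ω => ω.1.1) (fun ω => ((outInit ω.1, ω.1.2 (Fin.last k)), ω.2)) := by
  rw [aSeq, condEnt_comp_equiv (consSplit k)]
  have hp : pJoint α β k ∘ consSplit k = fun ω : Block k × Bool =>
      (1 / 2 : ℝ) ^ k * transD α β ω.2 (ω.1.2 0) * pathWeight α β ω.1.2 * initD α β ω.2 := by
    funext ω
    change (1 / 2 : ℝ) ^ k * (initD α β ω.2 *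
      pathWeight α β (Fin.cons ω.2 ω.1.2 : Fin (k + 2) → Bool)) = _
    rw [pathWeight_cons]
    ring
  rw [hp]
  refine condEnt_congr _ (fun ω ω' => Iff.rfl) (fun ω ω' => ?_)
  have h0 : ∀ ω : Block k × Bool, (consSplit k ω).2 0 = ω.2 := fun ω =>
    Fin.cons_zero (α := fun _ => Bool) ω.2 ω.1.2
  have hl : ∀ ω : Block k × Bool,
      (consSplit k ω).2 (Fin.last (k + 1)) = ω.1.2 (Fin.last k) := fun ω =>
    Fin.cons_succ (α := fun _ => Bool) ω.2 ω.1.2 (Fin.last k)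
  simp only [Function.comp_apply, yOut_consSplit, h0, hl, Prod.mk.injEq]
  tauto

/-- The joint pmf of the past and the future block. -/
def pSplit (α β : ℝ) (m k : ℕ) (ω : Block m × Block k) : ℝ :=
  (1 / 2 : ℝ) ^ m * pMarkov α β ω.1.2 * transD α β (ω.1.2 (Fin.last m)) (ω.2.2 0) *
    ((1 / 2 : ℝ) ^ k * pathWeight α β ω.2.2)

lemma pSplit_pos (hα : 0 < α ∧ α < 1) (hβ : 0 < β ∧ β < 1) (m k : ℕ) (ω : Block m × Block k) :
    0 < pSplit α β m k ω := by
  have h1 := pMarkov_pos hα hβ ω.1.2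
  have h2 := transD_pos hα hβ (ω.1.2 (Fin.last m)) (ω.2.2 0)
  have h3 := pathWeight_pos hα hβ ω.2.2
  unfold pSplit
  positivity

lemma aSeq_add_eq (m k : ℕ) :
    aSeq α β (m + k) = condEnt (pSplit α β m k) (fun ω => (ω.1.1, ω.2.1))
      (fun ω => (outTail ω.1 ++ outInit ω.2, ω.1.2 0, ω.2.2 (Fin.last k))) := by
  rw [aSeq, condEnt_comp_equiv (glueSplit m k)]
  have hp : pJoint α β (m + k) ∘ glueSplit m k = pSplit α β m k := by
    funext ω
    change (1 / 2 : ℝ) ^ (m + k) *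
      pMarkov α β (glue ω.1.2 ω.2.2 : Fin (m + k + 1 + 1) → Bool) = _
    rw [pMarkov_glue, pow_add, pSplit]
    ring
  rw [hp]
  refine condEnt_congr _ (fun ω ω' => ?_) (fun ω ω' => ?_)
  · refine ((Fin.appendEquiv (α := Bool) m k).injective.eq_iff
      (a := (ω.1.1, ω.2.1)) (b := (ω'.1.1, ω'.2.1)))
  · have h0 : ∀ ω : Block m × Block k, (glueSplit m k ω).2 0 = ω.1.2 0 := fun ω =>
      glue_left ω.1.2 ω.2.2 (i := 0) 0 rfl
    have hl : ∀ ω : Block m × Block k,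
        (glueSplit m k ω).2 (Fin.last (m + k + 1)) = ω.2.2 (Fin.last k) := fun ω =>
      glue_right _ _ (Fin.last k) (by simp; omega)
    simp only [Function.comp_apply, yOut_glueSplit, h0, hl]

lemma condEnt_past (hα : 0 < α ∧ α < 1) (hβ : 0 < β ∧ β < 1) (m k : ℕ) :
    condEnt (pSplit α β m k) (fun ω => ω.1.1)
      (fun ω => ((outTail ω.1, ω.1.2 0), (outInit ω.2, ω.2.2 0, ω.2.2 (Fin.last k)))) =
    aSeq α β m := by
  rw [aSeq_eq_snoc]
  refine condEnt_prod_eq (U := Block m) (W := Block k) (S := Bool)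
    (F := fun u s => (1 / 2 : ℝ) ^ m * pMarkov α β u.2 * transD α β (u.2 (Fin.last m)) s)
    (G := fun w => (1 / 2 : ℝ) ^ k * pathWeight α β w.2)
    (fun w => mul_pos (by positivity) (pathWeight_pos hα hβ _)) (fun w => w.2 0)
    (c := fun _ => 1) (fun _ => one_pos) (fun s => ?_) (fun u => u.1)
    (fun u => (outTail u, u.2 0)) (fun w => (outInit w, w.2 0, w.2 (Fin.last k)))
    (fun w w' h => ?_)
  · rw [Fintype.sum_prod_type, Finset.sum_comm]
    refine Eq.trans (Finset.sum_congr rfl fun d _ => ?_) (sum_pathWeight (α := α) (β := β) s)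
    by_cases h : d 0 = s
    · simp only [h, if_true, sum_source]
    · simp [h]
  · simp only [Prod.mk.injEq] at h
    exact h.2.1

lemma condEnt_future (hα : 0 < α ∧ α < 1) (hβ : 0 < β ∧ β < 1) (m k : ℕ) :
    condEnt (pSplit α β m k) (fun ω => ω.2.1)
      (fun ω => ((outInit ω.2, ω.2.2 (Fin.last k)), ω.1)) =
    aSeq α β k := by
  rw [aSeq_eq_cons, condEnt_comp_equiv (Equiv.prodComm (Block k) (Block m))]
  have hp : pSplit α β m k ∘ Equiv.prodComm (Block k) (Block m) = fun ω : Block k × Block m =>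
      (1 / 2 : ℝ) ^ k * transD α β (ω.2.2 (Fin.last m)) (ω.1.2 0) * pathWeight α β ω.1.2 *
        ((1 / 2 : ℝ) ^ m * pMarkov α β ω.2.2) := by
    funext ω
    simp only [Function.comp_apply, Equiv.prodComm_apply, pSplit, Prod.fst_swap, Prod.snd_swap]
    ring
  rw [hp]
  refine condEnt_prod_eq (U := Block k) (W := Block m) (S := Bool)
    (F := fun u s => (1 / 2 : ℝ) ^ k * transD α β s (u.2 0) * pathWeight α β u.2)
    (G := fun w => (1 / 2 : ℝ) ^ m * pMarkov α β w.2)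
    (fun w => mul_pos (by positivity) (pMarkov_pos hα hβ _)) (fun w => w.2 (Fin.last m))
    (c := initD α β) (initD_pos hα hβ) (fun s => ?_) (fun u => u.1)
    (fun u => (outInit u, u.2 (Fin.last k))) (fun w => w) (fun w w' h => by rw [h])
  rw [Fintype.sum_prod_type, Finset.sum_comm,
    ← sum_pMarkov_last (add_pos hα.1 hβ.1).ne' (k := m) s]
  refine Finset.sum_congr rfl fun d _ => ?_
  by_cases h : d (Fin.last m) = s
  · simp only [h, if_true, sum_source]
  · simp [h]

lemma aSeq_superadditive (hα : 0 < α ∧ α < 1) (hβ : 0 < β ∧ β < 1) (m k : ℕ) :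
    aSeq α β m + aSeq α β k ≤ aSeq α β (m + k) := by
  have hp := pSplit_pos hα hβ m k
  rw [aSeq_add_eq, condEnt_prodMk hp, ← condEnt_past hα hβ m k, ← condEnt_future hα hβ m k]
  refine add_le_add (condEnt_anti hp _ fun ω ω' h => ?_) (condEnt_anti hp _ fun ω ω' h => ?_)
  · simp only [Prod.mk.injEq] at h ⊢
    simp only [h, and_self]
  · simp only [Prod.mk.injEq] at h ⊢
    simp only [h, and_self]

lemma aSeq_le (hα : 0 < α ∧ α < 1) (hβ : 0 < β ∧ β < 1) (n : ℕ) : aSeq α β n ≤ n := by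
  have hne : α + β ≠ 0 := (add_pos hα.1 hβ.1).ne'
  have htot : ∑ ω, pJoint α β n ω = 1 := by
    simp only [Fintype.sum_prod_type, pJoint, ← Finset.mul_sum, sum_pMarkov hne]
    simp
  calc aSeq α β n ≤ condEnt (pJoint α β n) (fun ω => ω.1) (fun _ => ()) :=
        condEnt_anti (pJoint_pos hα hβ n) _ fun _ _ _ => rfl
    _ = n := by
      have hfib : ∀ ω, fiberProb (pJoint α β n) (fun ω => (ω.1, ())) ω = (1 / 2 : ℝ) ^ n := by
        intro ω
        simp only [fiberProb, Fintype.sum_prod_type, Prod.mk.injEq, and_true]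
        rw [Finset.sum_eq_single ω.1 (fun x _ hx => by simp [hx]) (by simp)]
        simp only [if_true, pJoint, ← Finset.mul_sum, sum_pMarkov hne, mul_one]
      have hunit : ∀ ω, fiberProb (pJoint α β n) (fun _ => ()) ω = 1 := by
        intro ω
        simp only [fiberProb, if_true, htot]
      simp only [condEnt_eq_sum, hfib, hunit, div_one, ← Finset.sum_mul, htot, Real.logb_pow]
      simp [Real.logb_inv]

end Split

/-- For every `α, β ∈ (0,1)`, the sequence
`a_n = H(X^n | y(X^n,D^n), D_0, D_{n+1})` is superadditive, hence `a_n/n` converges to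
`sup_{n ≥ 1} a_n/n`, which is at most `1`. -/
theorem aSeq_superadditive_limit (α β : ℝ) (hα : 0 < α ∧ α < 1) (hβ : 0 < β ∧ β < 1) :
    (∀ m n : ℕ, 1 ≤ m → m < n → aSeq α β m + aSeq α β (n - m) ≤ aSeq α β n) ∧
    Tendsto (fun n : ℕ => aSeq α β n / n) atTop
      (nhds (sSup {r : ℝ | ∃ n : ℕ, 1 ≤ n ∧ r = aSeq α β n / n})) ∧
    sSup {r : ℝ | ∃ n : ℕ, 1 ≤ n ∧ r = aSeq α β n / n} ≤ 1 := by
  have hsub : Subadditive fun n => -aSeq α β n := fun m k => by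
    have := aSeq_superadditive hα hβ m k
    dsimp only
    linarith
  have hle : ∀ n : ℕ, aSeq α β n / n ≤ 1 := fun n =>
    div_le_one_of_le₀ (aSeq_le hα hβ n) n.cast_nonneg
  have hset : Set.image (fun n : ℕ => -aSeq α β n / n) (Set.Ici 1) =
      -{r : ℝ | ∃ n : ℕ, 1 ≤ n ∧ r = aSeq α β n / n} := by
    ext r
    simp only [Set.mem_image, Set.mem_Ici, Set.mem_neg, Set.mem_ofPred_eq, neg_div]
    exact exists_congr fun n => and_congr_right fun _ => by
      rw [neg_eq_iff_eq_neg, eq_comm, neg_eq_iff_eq_neg]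
  refine ⟨fun m n _ hmn => ?_, ?_, ?_⟩
  · simpa [Nat.add_sub_cancel' hmn.le] using aSeq_superadditive hα hβ m (n - m)
  · have hlim := (hsub.tendsto_lim ⟨-1, ?_⟩).neg
    · rw [Subadditive.lim, hset, Real.sInf_neg, neg_neg] at hlim
      simpa only [neg_div, neg_neg] using hlim
    · rintro _ ⟨n, rfl⟩
      have := hle n
      simp only [neg_div]
      linarith
  · refine csSup_le ⟨_, 1, le_rfl, rfl⟩ ?_
    rintro _ ⟨n, _, rfl⟩
    exact hle n
end SyncDeletion
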